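/- Let V be a finite-dimensional vector space over a field, n ≥ 1, and let Λ₁, Λ₂ be nonzero decomposable n-vectors in ΛⁿV such that Λ₁ + Λ₂ is decomposable. Then the subspaces D₁ = D_{Λ₁} and D₂ = D_{Λ₂} satisfy dim(D₁ ∩ D₂) ≥ n − 1. -/

import Mathlib

/-- The wedge product `v₁ ∧ … ∧ vₙ` in the exterior algebra. -/
def wedgeProd (K : Type*) {V : Type*} [Field K] [AddCommGroup V] [Module K V] {n : ℕ}
    (v : Fin n → V) : ExteriorAlgebra K V :=
  (List.ofFn fun i => ExteriorAlgebra.ι K (v i)).prod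

/-- The subspace `D_Λ = {v : V | v ∧ Λ = 0}` determined by an `n`-vector `Λ`. -/
def decompSpan (K : Type*) {V : Type*} [Field K] [AddCommGroup V] [Module K V]
    (Λ : ExteriorAlgebra K V) : Submodule K V :=
  LinearMap.ker ((LinearMap.mulRight K Λ).comp (ExteriorAlgebra.ι K))

open ExteriorAlgebra in
lemma aux_ne_zero {K V : Type*} [Field K] [AddCommGroup V] [Module K V] {n : ℕ}
    (v : Fin n → V) (hv : LinearIndependent K v) : wedgeProd K v ≠ 0 := by
  have h := exteriorPower.ιMulti_family_linearIndependent_field (n := n) hv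
  have h2 := h.ne_zero (Set.powersetCard.ofFinEmbEquiv (RelEmbedding.refl (· ≤ ·)))
  intro h0
  apply h2
  apply Subtype.ext
  rw [exteriorPower.ιMulti_family, Equiv.symm_apply_apply]
  exact h0

lemma aux_li {K V : Type*} [Field K] [AddCommGroup V] [Module K V] {n : ℕ}
    (v : Fin n → V) (h : wedgeProd K v ≠ 0) : LinearIndependent K v := by
  by_contra hv
  exact h ((ExteriorAlgebra.ιMulti K n).map_linearDependent v hv)

lemma wedge_cons {K V : Type*} [Field K] [AddCommGroup V] [Module K V] {n : ℕ}
    (u : V) (v : Fin n → V) :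
    wedgeProd K (Fin.cons u v : Fin (n+1) → V) = ExteriorAlgebra.ι K u * wedgeProd K v := by
  simp [wedgeProd, List.ofFn_succ]

lemma mem_decompSpan {K V : Type*} [Field K] [AddCommGroup V] [Module K V]
    (Λ : ExteriorAlgebra K V) (u : V) :
    u ∈ decompSpan K Λ ↔ ExteriorAlgebra.ι K u * Λ = 0 := by
  simp [decompSpan]

lemma decompSpan_eq {K V : Type*} [Field K] [AddCommGroup V] [Module K V] {n : ℕ}
    (v : Fin n → V) (h : wedgeProd K v ≠ 0) :
    decompSpan K (wedgeProd K v) = Submodule.span K (Set.range v) := by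
  apply le_antisymm
  · intro u hu
    by_contra hn
    rw [mem_decompSpan, ← wedge_cons] at hu
    exact aux_ne_zero _ (linearIndependent_finCons.2 ⟨aux_li v h, hn⟩) hu
  · rw [Submodule.span_le]
    rintro _ ⟨i, rfl⟩
    rw [SetLike.mem_coe, mem_decompSpan]
    exact ExteriorAlgebra.ι_mul_prod_list v i

lemma finrank_decompSpan {K V : Type*} [Field K] [AddCommGroup V] [Module K V] {n : ℕ}
    (v : Fin n → V) (h : wedgeProd K v ≠ 0) :
    Module.finrank K (decompSpan K (wedgeProd K v)) = n := by
  rw [decompSpan_eq v h, finrank_span_eq_card (aux_li v h), Fintype.card_fin]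

lemma decompSpan_le_mul {K V : Type*} [Field K] [AddCommGroup V] [Module K V]
    (Λ : ExteriorAlgebra K V) (w : V) :
    decompSpan K Λ ≤ decompSpan K (ExteriorAlgebra.ι K w * Λ) := by
  intro u hu
  rw [mem_decompSpan] at *
  have h := ExteriorAlgebra.ι_add_mul_swap (R := K) u w
  rw [← mul_assoc, eq_neg_of_add_eq_zero_left h, neg_mul, mul_assoc, hu, mul_zero, neg_zero]

/-- If `Λ₁, Λ₂` are nonzero decomposable `n`-vectors with decomposable sum, then
`dim(D_{Λ₁} ∩ D_{Λ₂}) ≥ n − 1`. -/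
theorem intersection_of_decomposable_sum {K V : Type*} [Field K] [AddCommGroup V]
    [Module K V] [FiniteDimensional K V] {n : ℕ} (hn : 1 ≤ n)
    (Λ₁ Λ₂ : ExteriorAlgebra K V)
    (h₁ : ∃ v : Fin n → V, Λ₁ = wedgeProd K v) (hne₁ : Λ₁ ≠ 0)
    (h₂ : ∃ v : Fin n → V, Λ₂ = wedgeProd K v) (hne₂ : Λ₂ ≠ 0)
    (hsum : ∃ v : Fin n → V, Λ₁ + Λ₂ = wedgeProd K v) :
    n - 1 ≤ Module.finrank K ↥(decompSpan K Λ₁ ⊓ decompSpan K Λ₂) := by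
  obtain ⟨a, rfl⟩ := h₁
  obtain ⟨b, rfl⟩ := h₂
  obtain ⟨c, hc⟩ := hsum
  have fa := finrank_decompSpan a hne₁
  have fb := finrank_decompSpan b hne₂
  by_cases hle : decompSpan K (wedgeProd K c) ≤ decompSpan K (wedgeProd K a)
  · have hle2 : decompSpan K (wedgeProd K c) ≤
        decompSpan K (wedgeProd K a) ⊓ decompSpan K (wedgeProd K b) := by
      refine le_inf hle fun u hu => ?_
      have h1 := hle hu
      rw [mem_decompSpan] at *
      rwa [← hc, mul_add, h1, zero_add] at hu
    have hm := Submodule.finrank_mono hle2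
    by_cases h0 : wedgeProd K c = 0
    · have hle3 : decompSpan K (wedgeProd K a) ≤ decompSpan K (wedgeProd K c) := by
        intro u _
        rw [mem_decompSpan, h0, mul_zero]
      have := Submodule.finrank_mono hle3
      omega
    · have := finrank_decompSpan c h0
      omega
  · obtain ⟨w, hw, hwa⟩ := SetLike.not_le_iff_exists.1 hle
    rw [mem_decompSpan] at hw hwa
    have hwc := hwa
    rw [← wedge_cons] at hwc
    have fw := finrank_decompSpan _ hwc
    rw [wedge_cons] at fw
    rw [← hc, mul_add] at hw
    have l1 := decompSpan_le_mul (wedgeProd K a) w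
    have l2 : decompSpan K (wedgeProd K b) ≤
        decompSpan K (ExteriorAlgebra.ι K w * wedgeProd K a) := by
      refine (decompSpan_le_mul (wedgeProd K b) w).trans fun u hu => ?_
      rw [mem_decompSpan] at *
      rw [eq_neg_of_add_eq_zero_left hw, mul_neg, hu, neg_zero]
    have hs := Submodule.finrank_mono (sup_le l1 l2)
    have := Submodule.finrank_sup_add_finrank_inf_eq (decompSpan K (wedgeProd K a))
      (decompSpan K (wedgeProd K b))
    omega
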